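/- Let A = ⊕_{k∈Z} A_k be a finite-dimensional graded algebra over a field F and X a finite-dimensional graded right A-module. Then X is indecomposable as a graded module if and only if the underlying ungraded module For(X) is indecomposable. -/

import Mathlib

/-- A submodule `p` of a module `M` graded by `ℳ : ℤ → Submodule F M` is *graded*
(homogeneous) if, as an `F`-subspace, it is the sum of its intersections with the
homogeneous components. -/
def IsGradedSubmodule {F A M : Type} [Field F] [Ring A] [Algebra F A]
    [AddCommGroup M] [Module F M] [Module A M] [IsScalarTower F A M]
    (ℳ : ℤ → Submodule F M) (p : Submodule A M) : Prop :=
  p.restrictScalars F = ⨆ l : ℤ, (p.restrictScalars F ⊓ ℳ l)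

section GradedEnd

open DirectSum

variable {F A X : Type} [Field F] [Ring A] [AddCommGroup X] [Module F X] [Module A X]

/-- An `A`-linear endomorphism is homogeneous of degree `n` if it shifts the grading by `n`. -/
def IsHomogeneousEnd (ℳ : ℤ → Submodule F X) (n : ℤ) (f : Module.End A X) : Prop :=
  ∀ l, ∀ x ∈ ℳ l, f x ∈ ℳ (l + n)

/-- `g` is the degree `n` component of the endomorphism `f`. -/
def IsEndComponent (ℳ : ℤ → Submodule F X) [Decomposition ℳ] (n : ℤ) (f g : Module.End A X) :
    Prop :=
  ∀ l, ∀ x ∈ ℳ l, g x = decompose ℳ (f x) (l + n)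

variable (A) in
/-- A homogeneous subspace stable under all homogeneous `A`-linear endomorphisms. -/
structure IsGradedStable (ℳ : ℤ → Submodule F X) [Decomposition ℳ] (Y : Submodule F X) :
    Prop where
  isHomogeneous : SetLike.IsHomogeneous ℳ Y
  map_mem : ∀ (n : ℤ) (f : Module.End A X), IsHomogeneousEnd ℳ n f → ∀ x ∈ Y, f x ∈ Y

namespace IsHomogeneousEnd

variable {ℳ : ℤ → Submodule F X} {m n : ℤ} {f g : Module.End A X}

theorem mul (hf : IsHomogeneousEnd ℳ m f) (hg : IsHomogeneousEnd ℳ n g) :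
    IsHomogeneousEnd ℳ (n + m) (f * g) := fun l x hx => by
  rw [← add_assoc]
  exact hf _ _ (hg l x hx)

theorem one : IsHomogeneousEnd ℳ 0 (1 : Module.End A X) := fun l x hx => by
  simpa using hx

theorem pow (hf : IsHomogeneousEnd ℳ n f) (k : ℕ) : IsHomogeneousEnd ℳ (k * n) (f ^ k) := by
  induction k with
  | zero => simpa using one
  | succ k ih =>
    rw [pow_succ', Nat.cast_succ, add_mul, one_mul, add_comm]
    simpa [add_comm] using hf.mul ih

theorem decompose_apply [Decomposition ℳ] (hf : IsHomogeneousEnd ℳ n f) (l : ℤ) (x : X) :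
    (decompose ℳ (f x) (l + n) : X) = f (decompose ℳ x l) := by
  induction x using Decomposition.inductionOn ℳ with
  | zero => simp
  | add x y hx hy => simp [decompose_add, hx, hy]
  | @homogeneous i x =>
    obtain rfl | h := eq_or_ne i l
    · rw [decompose_of_mem_same ℳ (hf _ _ x.2), decompose_of_mem_same ℳ x.2]
    · rw [decompose_of_mem_ne ℳ (hf _ _ x.2) (by simpa using h), decompose_of_mem_ne ℳ x.2 h,
        map_zero]

end IsHomogeneousEnd

theorem IsEndComponent.isHomogeneousEnd {ℳ : ℤ → Submodule F X} [Decomposition ℳ] {n : ℤ}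
    {f g : Module.End A X} (h : IsEndComponent ℳ n f g) : IsHomogeneousEnd ℳ n g :=
  fun l x hx => h l x hx ▸ SetLike.coe_mem _

theorem mem_of_decompose_mem (ℳ : ℤ → Submodule F X) [Decomposition ℳ] (Y : Submodule F X) {x : X}
    (h : ∀ l, (decompose ℳ x l : X) ∈ Y) : x ∈ Y := by
  classical
  rw [← sum_support_decompose ℳ x]
  exact sum_mem fun l _ => h l

namespace IsGradedStable

variable {ℳ : ℤ → Submodule F X} [Decomposition ℳ] {Y Z : Submodule F X}

theorem bot : IsGradedStable A ℳ ⊥ where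
  isHomogeneous l x hx := by simp_all
  map_mem n f _ x hx := by simp_all

theorem top : IsGradedStable A ℳ ⊤ where
  isHomogeneous _ _ _ := Submodule.mem_top
  map_mem _ _ _ _ _ := Submodule.mem_top

theorem sup (hY : IsGradedStable A ℳ Y) (hZ : IsGradedStable A ℳ Z) :
    IsGradedStable A ℳ (Y ⊔ Z) where
  isHomogeneous l x hx := by
    obtain ⟨y, hy, z, hz, rfl⟩ := Submodule.mem_sup.1 hx
    simpa [decompose_add] using
      Submodule.add_mem_sup (hY.isHomogeneous l hy) (hZ.isHomogeneous l hz)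
  map_mem n f hf x hx := by
    obtain ⟨y, hy, z, hz, rfl⟩ := Submodule.mem_sup.1 hx
    simpa using Submodule.add_mem_sup (hY.map_mem n f hf y hy) (hZ.map_mem n f hf z hz)

end IsGradedStable

theorem not_injective_of_isHomogeneousEnd [FiniteDimensional F X] [Nontrivial X]
    {ℳ : ℤ → Submodule F X} [Decomposition ℳ] {n : ℤ} (hn : n ≠ 0)
    {f : Module.End A X} (hf : IsHomogeneousEnd ℳ n f) :
    ¬ Function.Injective f := fun hinj => by
  obtain ⟨x, hx⟩ := exists_ne (0 : X)
  obtain ⟨l, hl⟩ : ∃ l, (decompose ℳ x l : X) ≠ 0 := by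
    by_contra! h
    exact hx <| (Submodule.mem_bot F).1 <| mem_of_decompose_mem ℳ ⊥ fun l => by simp [h]
  have hfin : {i | ℳ i ≠ ⊥}.Finite :=
    WellFoundedGT.finite_ne_bot_of_iSupIndep (Decomposition.isInternal ℳ).submodule_iSupIndep
  refine Set.infinite_of_injective_forall_mem (f := fun k : ℕ => l + k * n)
    (fun a b h => by simpa [hn] using h) (fun k => ?_) hfin
  refine (Submodule.ne_bot_iff _).2 ⟨_, hf.pow k l _ (SetLike.coe_mem (decompose ℳ x l)), ?_⟩
  rw [Module.End.coe_pow]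
  exact fun h => hl (hinj.iterate k (h.trans (by rw [← Module.End.coe_pow, map_zero])))

theorem IsGradedStable.exists_maximal_lt [FiniteDimensional F X]
    {ℳ : ℤ → Submodule F X} [Decomposition ℳ] {Y : Submodule F X} (hY : Y ≠ ⊥) :
    ∃ Z, Maximal (fun Z => IsGradedStable A ℳ Z ∧ Z < Y) Z := by
  obtain ⟨Z, hZ, hmax⟩ := wellFounded_gt.has_min {Z | IsGradedStable A ℳ Z ∧ Z < Y}
    ⟨⊥, .bot, bot_lt_iff_ne_bot.2 hY⟩
  exact ⟨Z, hZ, fun W hW hZW => not_lt_iff_le_imp_ge.1 (hmax W hW) hZW⟩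

variable [Algebra F A]

theorem decompose_smul_of_mem {𝒜 : ℤ → Submodule F A} (ℳ : ℤ → Submodule F X) [Decomposition ℳ]
    (hsmul : ∀ (k l : ℤ), ∀ a ∈ 𝒜 k, ∀ x ∈ ℳ l, a • x ∈ ℳ (l + k)) {k : ℤ} {a : A} (ha : a ∈ 𝒜 k)
    (l : ℤ) (x : X) : (decompose ℳ (a • x) (l + k) : X) = a • (decompose ℳ x l : X) := by
  induction x using Decomposition.inductionOn ℳ with
  | zero => simp
  | add x y hx hy => simp [decompose_add, hx, hy]
  | @homogeneous i x =>
    obtain rfl | h := eq_or_ne i l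
    · rw [decompose_of_mem_same ℳ (hsmul _ _ _ ha _ x.2), decompose_of_mem_same ℳ x.2]
    · rw [decompose_of_mem_ne ℳ (hsmul _ _ _ ha _ x.2) (by simpa using h),
        decompose_of_mem_ne ℳ x.2 h, smul_zero]

variable [IsScalarTower F A X]

theorem isGradedSubmodule_of_isHomogeneous (ℳ : ℤ → Submodule F X) [Decomposition ℳ]
    {p : Submodule A X} (h : SetLike.IsHomogeneous ℳ p) : IsGradedSubmodule ℳ p := by
  refine le_antisymm (fun x hx => ?_) (iSup_le fun l => inf_le_left)
  exact mem_of_decompose_mem ℳ _ fun l => Submodule.mem_iSup_of_mem l ⟨h l hx, SetLike.coe_mem _⟩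

theorem exists_isEndComponent {𝒜 : ℤ → Submodule F A} (h𝒜 : ⨆ k, 𝒜 k = ⊤)
    (ℳ : ℤ → Submodule F X) [Decomposition ℳ]
    (hsmul : ∀ (k l : ℤ), ∀ a ∈ 𝒜 k, ∀ x ∈ ℳ l, a • x ∈ ℳ (l + k)) (f : Module.End A X) (n : ℤ) :
    ∃ g : Module.End A X, IsEndComponent ℳ n f g := by
  let φ : X →ₗ[F] X := (toModule F ℤ X fun l =>
    (ℳ (l + n)).subtype ∘ₗ component F ℤ (fun i => ℳ i) (l + n) ∘ₗ
      (decomposeLinearEquiv ℳ).toLinearMap ∘ₗ f.restrictScalars F ∘ₗ (ℳ l).subtype) ∘ₗ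
    (decomposeLinearEquiv ℳ).toLinearMap
  have hφ : ∀ l, ∀ x ∈ ℳ l, φ x = decompose ℳ (f x) (l + n) := fun l x hx => by
    lift x to ℳ l using hx
    simp only [φ, LinearMap.comp_apply, LinearEquiv.coe_coe, decomposeLinearEquiv_apply_coe,
      toModule_lof]
    rfl
  have hφA : ∀ (a : A) (x : X), φ (a • x) = a • φ x := fun a x => by
    induction x using Decomposition.inductionOn ℳ with
    | zero => simp
    | add x y hx hy => simp [hx, hy]
    | @homogeneous l x =>
      have ha : a ∈ ⨆ k, 𝒜 k := h𝒜 ▸ Submodule.mem_top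
      induction ha using Submodule.iSup_induction' with
      | zero => simp
      | add a b _ _ ha hb => simp [add_smul, ha, hb]
      | mem k a ha =>
        rw [hφ _ _ (hsmul _ _ _ ha _ x.2), hφ _ _ x.2, map_smul, add_right_comm,
          decompose_smul_of_mem ℳ hsmul ha]
  exact ⟨{ φ with map_smul' := hφA }, hφ⟩

namespace IsGradedStable

variable {ℳ : ℤ → Submodule F X} [Decomposition ℳ]

/-- The orbit of a homogeneous vector under the homogeneous endomorphisms spans a stable
subspace. -/
theorem span_orbit {d : ℤ} {w : X} (hw : w ∈ ℳ d) :
    IsGradedStable A ℳ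
      (Submodule.span F {v | ∃ n, ∃ f : Module.End A X, IsHomogeneousEnd ℳ n f ∧ f w = v}) where
  isHomogeneous l x hx := by
    induction hx using Submodule.span_induction with
    | zero => simp
    | add x y _ _ hx hy => simpa [decompose_add] using add_mem hx hy
    | smul c x _ hx =>
      rw [decompose_smul]
      exact Submodule.smul_mem _ c hx
    | mem x hx =>
      obtain ⟨n, f, hf, rfl⟩ := hx
      obtain rfl | h := eq_or_ne (d + n) l
      · rw [decompose_of_mem_same ℳ (hf _ _ hw)]
        exact Submodule.subset_span ⟨n, f, hf, rfl⟩
      · rw [decompose_of_mem_ne ℳ (hf _ _ hw) h]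
        exact zero_mem _
  map_mem n f hf x hx := by
    induction hx using Submodule.span_induction with
    | zero => simp
    | add x y _ _ hx hy => simpa using add_mem hx hy
    | smul c x _ hx =>
      have h : f (c • x) = c • f x := (f.restrictScalars F).map_smul c x
      exact h ▸ Submodule.smul_mem _ c hx
    | mem x hx =>
      obtain ⟨m, g, hg, rfl⟩ := hx
      exact Submodule.subset_span ⟨_, f * g, hf.mul hg, rfl⟩

end IsGradedStable

theorem exists_isHomogeneousEnd_of_mem_span {ℳ : ℤ → Submodule F X} [Decomposition ℳ] {d : ℤ}
    {w v : X} (hw : w ∈ ℳ d) (l : ℤ)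
    (hv : v ∈ Submodule.span F
      {v | ∃ n, ∃ f : Module.End A X, IsHomogeneousEnd ℳ n f ∧ f w = v}) :
    ∃ f : Module.End A X, IsHomogeneousEnd ℳ (l - d) f ∧ f w = decompose ℳ v l := by
  induction hv using Submodule.span_induction with
  | zero => exact ⟨0, fun _ _ _ => zero_mem _, by simp⟩
  | add x y _ _ hx hy =>
    obtain ⟨f, hf, hfx⟩ := hx
    obtain ⟨g, hg, hgy⟩ := hy
    exact ⟨f + g, fun i z hz => add_mem (hf i z hz) (hg i z hz), by
      simp [decompose_add, hfx, hgy]⟩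
  | smul c x _ hx =>
    obtain ⟨f, hf, hfx⟩ := hx
    exact ⟨c • f, fun i z hz => Submodule.smul_mem _ c (hf i z hz), by
      rw [decompose_smul, LinearMap.smul_apply, hfx]; rfl⟩
  | mem x hx =>
    obtain ⟨n, f, hf, rfl⟩ := hx
    obtain rfl | h := eq_or_ne (d + n) l
    · exact ⟨f, by simpa using hf, by rw [decompose_of_mem_same ℳ (hf _ _ hw)]⟩
    · exact ⟨0, fun _ _ _ => zero_mem _, by rw [decompose_of_mem_ne ℳ (hf _ _ hw) h]; rfl⟩

variable [FiniteDimensional F X]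

/-- The graded Fitting lemma. -/
theorem isNilpotent_of_isHomogeneousEnd_zero {ℳ : ℤ → Submodule F X} [Decomposition ℳ]
    (hX : ∀ p q : Submodule A X, IsGradedSubmodule ℳ p → IsGradedSubmodule ℳ q →
      IsCompl p q → p = ⊥ ∨ q = ⊥)
    {f : Module.End A X} (hf : IsHomogeneousEnd ℳ 0 f) (hinj : ¬ Function.Injective f) :
    IsNilpotent f := by
  have : IsNoetherian A X := isNoetherian_of_tower F inferInstance
  have : IsArtinian A X := isArtinian_of_tower F inferInstance
  obtain ⟨k, hk, hk0⟩ :=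
    (f.eventually_isCompl_ker_pow_range_pow.and (Filter.eventually_ne_atTop 0)).exists
  have hfk : IsHomogeneousEnd ℳ 0 (f ^ k) := by simpa using hf.pow k
  have hdec : ∀ l x, (decompose ℳ ((f ^ k) x) l : X) = (f ^ k) (decompose ℳ x l) := fun l x => by
    rw [← hfk.decompose_apply l x, add_zero]
  refine (hX _ _ (isGradedSubmodule_of_isHomogeneous ℳ fun l x hx => ?_)
    (isGradedSubmodule_of_isHomogeneous ℳ fun l x hx => ?_) hk).elim (fun h => ?_)
    fun h => ⟨k, LinearMap.range_eq_bot.1 h⟩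
  · rw [LinearMap.mem_ker] at hx ⊢
    rw [← hdec, hx]
    simp
  · obtain ⟨y, rfl⟩ := hx
    exact ⟨_, (hdec l y).symm⟩
  · have hkinj := LinearMap.ker_eq_bot.1 h
    rw [Module.End.coe_pow] at hkinj
    obtain ⟨k, rfl⟩ := Nat.exists_eq_succ_of_ne_zero hk0
    rw [Function.iterate_succ] at hkinj
    exact absurd hkinj.of_comp hinj

/-- A non-injective homogeneous endomorphism annihilates every simple graded stable subquotient. -/
theorem IsHomogeneousEnd.apply_mem_of_maximal [Nontrivial X] {ℳ : ℤ → Submodule F X}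
    [Decomposition ℳ]
    (hX : ∀ p q : Submodule A X, IsGradedSubmodule ℳ p → IsGradedSubmodule ℳ q →
      IsCompl p q → p = ⊥ ∨ q = ⊥)
    {Y Z : Submodule F X} (hY : IsGradedStable A ℳ Y)
    (hZ : Maximal (fun Z => IsGradedStable A ℳ Z ∧ Z < Y) Z)
    {n : ℤ} {f : Module.End A X} (hf : IsHomogeneousEnd ℳ n f) (hinj : ¬ Function.Injective f)
    {y : X} (hy : y ∈ Y) : f y ∈ Z := by
  refine mem_of_decompose_mem ℳ Z fun i => ?_
  obtain ⟨d, rfl⟩ : ∃ d, d + n = i := ⟨i - n, sub_add_cancel i n⟩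
  rw [hf.decompose_apply]
  set x : X := (decompose ℳ y d : X) with hxdef
  have hxY : x ∈ Y := hY.isHomogeneous d hy
  have hxd : x ∈ ℳ d := SetLike.coe_mem _
  clear_value x
  by_contra hfx
  have hw : f x ∈ ℳ (d + n) := hf d x hxd
  let W : Submodule F X := Submodule.span F
    {v | ∃ n, ∃ g : Module.End A X, IsHomogeneousEnd ℳ n g ∧ g (f x) = v}
  have hWY : W ≤ Y := Submodule.span_le.2 <| by
    rintro _ ⟨m, g, hg, rfl⟩
    exact hY.map_mem m g hg _ (hY.map_mem n f hf x hxY)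
  have hfxW : f x ∈ W := Submodule.subset_span ⟨0, 1, .one, rfl⟩
  have hsup : Z ⊔ W = Y := by
    by_contra hne
    exact hfx (hZ.2 ⟨hZ.1.1.sup (.span_orbit hw), lt_of_le_of_ne (sup_le hZ.1.2.le hWY) hne⟩
      le_sup_left (Submodule.mem_sup_right hfxW))
  obtain ⟨z, hz, v, hv, hzv⟩ := Submodule.mem_sup.1 (hsup.symm ▸ hxY)
  obtain ⟨g, hg, hgv⟩ := exists_isHomogeneousEnd_of_mem_span hw d hv
  have hu : IsHomogeneousEnd ℳ 0 (g * f) := by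
    have := hg.mul hf
    rwa [show n + (d - (d + n)) = 0 by ring] at this
  obtain ⟨k, hk⟩ := isNilpotent_of_isHomogeneousEnd_zero hX hu fun h =>
    hinj (Function.Injective.of_comp (f := g) h)
  have hxu : x - (g * f) x ∈ Z := by
    have : x - (g * f) x = decompose ℳ z d := by
      rw [Module.End.mul_apply, hgv, sub_eq_iff_eq_add, ← Submodule.coe_add, ← DirectSum.add_apply,
        ← decompose_add, hzv, decompose_of_mem_same ℳ hxd]
    exact this ▸ hZ.1.1.isHomogeneous d hz
  have hxk : ∀ k : ℕ, x - ((g * f) ^ k) x ∈ Z := fun k => by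
    induction k with
    | zero => simp
    | succ k ih =>
      have := add_mem hxu (hZ.1.1.map_mem 0 _ hu _ ih)
      rwa [map_sub, sub_add_sub_cancel, ← Module.End.mul_apply, ← pow_succ'] at this
  have hxZ : x ∈ Z := by simpa [hk] using hxk k
  exact hfx (hZ.1.1.map_mem n f hf x hxZ)

/-- Modulo a simple graded stable subquotient, every endomorphism agrees with its degree zero
component. -/
theorem sub_apply_mem_of_maximal [Nontrivial X] {𝒜 : ℤ → Submodule F A} (h𝒜 : ⨆ k, 𝒜 k = ⊤)
    {ℳ : ℤ → Submodule F X} [Decomposition ℳ]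
    (hsmul : ∀ (k l : ℤ), ∀ a ∈ 𝒜 k, ∀ x ∈ ℳ l, a • x ∈ ℳ (l + k))
    (hX : ∀ p q : Submodule A X, IsGradedSubmodule ℳ p → IsGradedSubmodule ℳ q →
      IsCompl p q → p = ⊥ ∨ q = ⊥)
    {Y Z : Submodule F X} (hY : IsGradedStable A ℳ Y)
    (hZ : Maximal (fun Z => IsGradedStable A ℳ Z ∧ Z < Y) Z)
    {f f₀ : Module.End A X} (hf : IsEndComponent ℳ 0 f f₀) {y : X} (hy : y ∈ Y) :
    f y - f₀ y ∈ Z := by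
  have key : ∀ d, ∀ x ∈ ℳ d, x ∈ Y → f x - f₀ x ∈ Z := fun d x hxd hxY => by
    refine mem_of_decompose_mem ℳ Z fun l => ?_
    rw [decompose_sub, DirectSum.sub_apply, Submodule.coe_sub]
    obtain rfl | h := eq_or_ne d l
    · have h₀ := hf d x hxd
      rw [add_zero] at h₀
      rw [h₀, decompose_of_mem_same ℳ (SetLike.coe_mem _), sub_self]
      exact zero_mem _
    · obtain ⟨g, hg⟩ := exists_isEndComponent h𝒜 ℳ hsmul f (l - d)
      have hgx := hg d x hxd
      rw [add_sub_cancel] at hgx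
      rw [decompose_of_mem_ne ℳ (hf.isHomogeneousEnd d x hxd) (by simpa using h), sub_zero, ← hgx]
      have hld : l - d ≠ 0 := sub_ne_zero.2 h.symm
      exact hg.isHomogeneousEnd.apply_mem_of_maximal hX hY hZ
        (not_injective_of_isHomogeneousEnd hld hg.isHomogeneousEnd) hxY
  classical
  rw [← sum_support_decompose ℳ y, map_sum, map_sum, ← Finset.sum_sub_distrib]
  exact sum_mem fun l _ => key l _ (SetLike.coe_mem _) (hY.isHomogeneous l hy)

/-- An idempotent whose degree zero component is not injective vanishes. -/
theorem eq_zero_of_isIdempotentElem [Nontrivial X] {𝒜 : ℤ → Submodule F A} (h𝒜 : ⨆ k, 𝒜 k = ⊤)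
    {ℳ : ℤ → Submodule F X} [Decomposition ℳ]
    (hsmul : ∀ (k l : ℤ), ∀ a ∈ 𝒜 k, ∀ x ∈ ℳ l, a • x ∈ ℳ (l + k))
    (hX : ∀ p q : Submodule A X, IsGradedSubmodule ℳ p → IsGradedSubmodule ℳ q →
      IsCompl p q → p = ⊥ ∨ q = ⊥)
    {e e₀ : Module.End A X} (he : IsIdempotentElem e) (he₀ : IsEndComponent ℳ 0 e e₀)
    (hinj : ¬ Function.Injective e₀) : e = 0 := by
  have key : ∀ Y : Submodule F X, IsGradedStable A ℳ Y → (∀ x, e x ∈ Y) → e = 0 := fun Y => by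
    induction Y using WellFoundedLT.induction with
    | ind Y ih =>
      intro hY heY
      obtain rfl | hne := eq_or_ne Y ⊥
      · exact LinearMap.ext heY
      obtain ⟨Z, hZ⟩ := IsGradedStable.exists_maximal_lt (A := A) (ℳ := ℳ) hne
      refine ih Z hZ.1.2 hZ.1.1 fun x => ?_
      have hsub := sub_apply_mem_of_maximal h𝒜 hsmul hX hY hZ he₀ (heY x)
      rw [← Module.End.mul_apply, he.eq] at hsub
      exact (Submodule.sub_mem_iff_left Z <|
        he₀.isHomogeneousEnd.apply_mem_of_maximal hX hY hZ hinj (heY x)).1 hsub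
  exact key ⊤ .top fun _ => Submodule.mem_top

/-- The endomorphism ring of a graded-indecomposable module has only trivial idempotents. -/
theorem eq_zero_or_eq_one_of_isIdempotentElem [Nontrivial X] {𝒜 : ℤ → Submodule F A}
    (h𝒜 : ⨆ k, 𝒜 k = ⊤) {ℳ : ℤ → Submodule F X} [Decomposition ℳ]
    (hsmul : ∀ (k l : ℤ), ∀ a ∈ 𝒜 k, ∀ x ∈ ℳ l, a • x ∈ ℳ (l + k))
    (hX : ∀ p q : Submodule A X, IsGradedSubmodule ℳ p → IsGradedSubmodule ℳ q →
      IsCompl p q → p = ⊥ ∨ q = ⊥)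
    {e : Module.End A X} (he : IsIdempotentElem e) : e = 0 ∨ e = 1 := by
  obtain ⟨e₀, he₀⟩ := exists_isEndComponent h𝒜 ℳ hsmul e 0
  by_cases hinj : Function.Injective e₀
  swap
  · exact .inl (eq_zero_of_isIdempotentElem h𝒜 hsmul hX he he₀ hinj)
  have he₀' : IsEndComponent ℳ 0 (1 - e) (1 - e₀) := fun l x hx => by
    rw [LinearMap.sub_apply, LinearMap.sub_apply, decompose_sub, DirectSum.sub_apply,
      Submodule.coe_sub, ← he₀ l x hx, Module.End.one_apply, add_zero, decompose_of_mem_same ℳ hx]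
  by_cases hinj' : Function.Injective (1 - e₀ : Module.End A X)
  swap
  · exact .inr (sub_eq_zero.1 (eq_zero_of_isIdempotentElem h𝒜 hsmul hX he.one_sub he₀' hinj')).symm
  obtain ⟨Z, hZ⟩ := IsGradedStable.exists_maximal_lt (A := A) (ℳ := ℳ) (Y := ⊤) top_ne_bot
  have hsub : ∀ y, e y - e₀ y ∈ Z := fun y =>
    sub_apply_mem_of_maximal h𝒜 hsmul hX .top hZ he₀ Submodule.mem_top
  have hZ₀ : ∀ z ∈ Z, e₀ z ∈ Z := hZ.1.1.map_mem 0 e₀ he₀.isHomogeneousEnd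
  have hmem : ∀ y, e₀ ((1 - e₀) y) ∈ Z := fun y => by
    have hey : e (e y) = e y := by rw [← Module.End.mul_apply, he.eq]
    have h₁ := add_mem (sub_mem (hsub (e y)) (hsub y)) (hZ₀ _ (hsub y))
    rw [hey, map_sub] at h₁
    rw [LinearMap.sub_apply, Module.End.one_apply, map_sub]
    convert h₁ using 1
    abel
  have hsurj : Function.Surjective (e₀ * (1 - e₀) : Module.End A X) :=
    (LinearMap.injective_iff_surjective (f := (e₀ * (1 - e₀)).restrictScalars F)).1
      (hinj.comp hinj')
  refine absurd ?_ hZ.1.2.ne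
  refine eq_top_iff.2 fun x _ => ?_
  obtain ⟨y, rfl⟩ := hsurj x
  exact hmem y

end GradedEnd

/-- Let `A = ⊕ₖ Aₖ` be a finite-dimensional graded algebra over a field `F` and
`X` a finite-dimensional graded (right) `A`-module (grading convention
`X_l · A_k ⊆ X_{l+k}`).  Then `X` is indecomposable as a graded module if and only
if the underlying ungraded module `For(X)` is indecomposable. -/
theorem graded_indecomposable_iff
    (F A : Type) [Field F] [Ring A] [Algebra F A] [FiniteDimensional F A]
    (𝒜 : ℤ → Submodule F A) (h𝒜 : DirectSum.IsInternal 𝒜)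
    (h𝒜mul : ∀ (k l : ℤ), ∀ a ∈ 𝒜 k, ∀ b ∈ 𝒜 l, a * b ∈ 𝒜 (k + l))
    (X : Type) [AddCommGroup X] [Module F X] [Module A X] [IsScalarTower F A X]
    [FiniteDimensional F X]
    (ℳ : ℤ → Submodule F X) (hℳ : DirectSum.IsInternal ℳ)
    (hsmul : ∀ (k l : ℤ), ∀ a ∈ 𝒜 k, ∀ x ∈ ℳ l, a • x ∈ ℳ (l + k)) :
    (Nontrivial X ∧ ∀ p q : Submodule A X,
        IsGradedSubmodule ℳ p → IsGradedSubmodule ℳ q →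
        IsCompl p q → p = ⊥ ∨ q = ⊥) ↔
    (Nontrivial X ∧ ∀ p q : Submodule A X, IsCompl p q → p = ⊥ ∨ q = ⊥) := by
  refine and_congr_right fun _ => ⟨fun hX p q hpq => ?_, fun hX p q _ _ => hX p q⟩
  let := hℳ.chooseDecomposition
  have he : IsIdempotentElem (p.projection q hpq) :=
    LinearMap.ext fun x => Submodule.projection_apply_of_mem_left hpq
      (Submodule.projection_apply_mem hpq x)
  refine (eq_zero_or_eq_one_of_isIdempotentElem h𝒜.submodule_iSup_eq_top hsmul hX he).imp
    (fun h => ?_) fun h => ?_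
  · rw [← Submodule.range_projection hpq, h, LinearMap.range_zero]
  · rw [← Submodule.ker_projection hpq, h]
    exact LinearMap.ker_id
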